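/- Let Ω be a bounded domain of ℝⁿ, n ≥ 2, let p > 1 and let Q be a cube compactly contained in Ω. Suppose that for all vector fields v ∈ W^{1,p}(Ω)ⁿ one has ‖Dv‖_{L^p(Ω)} ≤ C { ‖ε(v)‖_{L^p(Ω)} + ‖v‖_{L^p(Q)} }. Then there exists C' > 0 such that for all u ∈ W^{1,p}(Ω) one has ∫_Ω |u(x) − u_Ω|^p dx ≤ C' ∫_Ω |∇u(x)|^p dx. -/

import Mathlib

open MeasureTheory Set Filter
open scoped ENNReal NNReal Topology

noncomputable section

abbrev Evec (n : ℕ) := EuclideanSpace ℝ (Fin n)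

/-- `ρ(x) = dist(x, ∂Ω)`, the distance to the boundary of `Ω`. -/
def bdist {n : ℕ} (Ω : Set (Evec n)) (x : Evec n) : ℝ := Metric.infDist x (frontier Ω)

/-- A bounded domain: open, connected and bounded. -/
def IsBoundedDomain {n : ℕ} (Ω : Set (Evec n)) : Prop :=
  IsOpen Ω ∧ IsConnected Ω ∧ Bornology.IsBounded Ω

/-- A closed cube in `ℝⁿ`. -/
def IsClosedCube {n : ℕ} (Q : Set (Evec n)) : Prop :=
  ∃ (c : Evec n) (r : ℝ), 0 < r ∧ Q = {x : Evec n | ∀ i, |x i - c i| ≤ r}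

/-- The weighted `p`-energy `∫_S |g(x)|^p ρ(x)^a dx`, where `ρ` is the distance
to the boundary of `Ω`. -/
def wIp {n : ℕ} (Ω S : Set (Evec n)) (p a : ℝ) (g : Evec n → ℝ) : ℝ≥0∞ :=
  ∫⁻ x in S, ENNReal.ofReal (|g x| ^ p * bdist Ω x ^ a)

/-- The weighted `L^p(S, ρ^a)` norm `(∫_S |g(x)|^p ρ(x)^a dx)^{1/p}`. -/
def wLp {n : ℕ} (Ω S : Set (Evec n)) (p a : ℝ) (g : Evec n → ℝ) : ℝ≥0∞ :=
  wIp Ω S p a g ^ (1 / p)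

/-- The weighted average `u_{Ω,a} = (∫_Ω ρ^a)⁻¹ ∫_Ω u ρ^a`. -/
def wAvg {n : ℕ} (Ω : Set (Evec n)) (a : ℝ) (u : Evec n → ℝ) : ℝ :=
  (∫ x in Ω, bdist Ω x ^ a)⁻¹ * ∫ x in Ω, u x * bdist Ω x ^ a

/-- `|∇u(x)|` for a scalar function `u`. -/
def gradLen {n : ℕ} (u : Evec n → ℝ) (x : Evec n) : ℝ := ‖fderiv ℝ u x‖

/-- The entry `∂v_i/∂x_j (x)` of the gradient matrix `Dv`. -/
def pder {n : ℕ} (v : Evec n → Evec n) (i j : Fin n) (x : Evec n) : ℝ :=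
  fderiv ℝ v x (EuclideanSpace.single j 1) i

/-- `|Dv(x)|`, the (Frobenius) norm of the gradient matrix of a vector field `v`. -/
def DvLen {n : ℕ} (v : Evec n → Evec n) (x : Evec n) : ℝ :=
  Real.sqrt (∑ i, ∑ j, pder v i j x ^ 2)

/-- `|ε(v)(x)|`, the norm of the symmetric part `ε_{ij}(v) = (∂v_i/∂x_j + ∂v_j/∂x_i)/2`
of the gradient matrix. -/
def epsLen {n : ℕ} (v : Evec n → Evec n) (x : Evec n) : ℝ :=
  Real.sqrt (∑ i, ∑ j, ((pder v i j x + pder v j i x) / 2) ^ 2)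

/-- `u ∈ W^{1,p}(Ω, ρ^a, ρ^b)` (scalar case). -/
def MemW1 {n : ℕ} (Ω : Set (Evec n)) (p a b : ℝ) (u : Evec n → ℝ) : Prop :=
  DifferentiableOn ℝ u Ω ∧ wIp Ω Ω p a u < ⊤ ∧ wIp Ω Ω p b (gradLen u) < ⊤

/-- `v ∈ W^{1,p}(Ω, ρ^a, ρ^b)ⁿ` (vector case). -/
def MemW1Vec {n : ℕ} (Ω : Set (Evec n)) (p a b : ℝ) (v : Evec n → Evec n) : Prop :=
  DifferentiableOn ℝ v Ω ∧ wIp Ω Ω p a (fun x => ‖v x‖) < ⊤ ∧ wIp Ω Ω p b (DvLen v) < ⊤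

/-- The weighted Poincaré inequality `(P_{p,a,b})`: there is `C > 0` such that
`∫_Ω |u - u_{Ω,a}|^p ρ^a ≤ C ∫_Ω |∇u|^p ρ^b` for all `u ∈ W^{1,p}(Ω,ρ^a,ρ^b)`. -/
def PoincareIneq {n : ℕ} (Ω : Set (Evec n)) (p a b : ℝ) : Prop :=
  ∃ C > 0, ∀ u : Evec n → ℝ, MemW1 Ω p a b u →
    wIp Ω Ω p a (fun x => u x - wAvg Ω a u) ≤ ENNReal.ofReal C * wIp Ω Ω p b (gradLen u)

theorem wIp_zero_eq_lintegral {n : ℕ} (Ω S : Set (Evec n)) {p : ℝ} (hp : 0 ≤ p)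
    (g : Evec n → ℝ) : wIp Ω S p 0 g = ∫⁻ x in S, ‖g x‖ₑ ^ p := by
  simp only [wIp, Real.rpow_zero, mul_one]
  refine lintegral_congr fun x => ?_
  rw [← ENNReal.ofReal_rpow_of_nonneg (abs_nonneg _) hp, Real.enorm_eq_ofReal_abs]

theorem wLp_zero_eq_eLpNorm {n : ℕ} (Ω S : Set (Evec n)) {p : ℝ} (hp : 0 < p)
    (g : Evec n → ℝ) : wLp Ω S p 0 g = eLpNorm g (ENNReal.ofReal p) (volume.restrict S) := by
  rw [wLp, wIp_zero_eq_lintegral Ω S hp.le,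
    eLpNorm_eq_lintegral_rpow_enorm_toReal (by simpa using hp) ENNReal.ofReal_ne_top,
    ENNReal.toReal_ofReal hp.le]

theorem wIp_zero_eq_eLpNorm_rpow {n : ℕ} (Ω S : Set (Evec n)) {p : ℝ} (hp : 0 < p)
    (g : Evec n → ℝ) :
    wIp Ω S p 0 g = eLpNorm g (ENNReal.ofReal p) (volume.restrict S) ^ p := by
  rw [← wLp_zero_eq_eLpNorm Ω S hp, wLp, ← ENNReal.rpow_mul, one_div_mul_cancel hp.ne',
    ENNReal.rpow_one]

section ConvexPoincare

variable {E : Type*} [NormedAddCommGroup E] [NormedSpace ℝ E]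

/-- The mean value inequality along a segment, in `L^p` form. No integrability of the derivative
is assumed. -/
theorem enorm_sub_rpow_le_lintegral_fderiv_segment [MeasurableSpace E] [BorelSpace E]
    [FiniteDimensional ℝ E] {u : E → ℝ} {x y : E} {p : ℝ} (hp : 1 ≤ p)
    (hu : ∀ t ∈ Icc (0 : ℝ) 1, DifferentiableAt ℝ u ((1 - t) • x + t • y)) :
    ‖u y - u x‖ₑ ^ p ≤
      ‖y - x‖ₑ ^ p * ∫⁻ t in Ioc (0 : ℝ) 1, ‖fderiv ℝ u ((1 - t) • x + t • y)‖ₑ ^ p := by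
  have hp0 : 0 < p := zero_lt_one.trans_le hp
  set γ : ℝ → E := fun t => (1 - t) • x + t • y with hγ
  set φ' : ℝ → ℝ := fun t => fderiv ℝ u (γ t) (y - x) with hφ'
  have hγm : Measurable γ := by
    have : Continuous γ := by fun_prop
    exact this.measurable
  have hφm : Measurable φ' := (measurable_fderiv_apply_const ℝ u (y - x)).comp hγm
  have hder : ∀ t ∈ uIcc (0 : ℝ) 1, HasDerivAt (u ∘ γ) (φ' t) t := by
    intro t ht
    rw [uIcc_of_le zero_le_one] at ht
    have h1 : HasDerivAt γ (y - x) t := by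
      have h2 := (((hasDerivAt_const t (1 : ℝ)).sub (hasDerivAt_id t)).smul_const x).add
        ((hasDerivAt_id t).smul_const y)
      refine HasDerivAt.congr_deriv h2 ?_
      module
    exact (hu t ht).hasFDerivAt.comp_hasDerivAt t h1
  set ν : Measure ℝ := volume.restrict (Ioc (0 : ℝ) 1) with hν
  have : IsProbabilityMeasure ν := ⟨by simp [hν]⟩
  have hL1 : ‖u y - u x‖ₑ ≤ eLpNorm φ' 1 ν := by
    rw [eLpNorm_one_eq_lintegral_enorm]
    by_cases hfin : ∫⁻ t, ‖φ' t‖ₑ ∂ν = ⊤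
    · rw [hfin]; exact le_top
    · have hint : Integrable φ' ν := ⟨hφm.aestronglyMeasurable, lt_top_iff_ne_top.2 hfin⟩
      have hftc := intervalIntegral.integral_eq_sub_of_hasDerivAt hder
        ((intervalIntegrable_iff_integrableOn_Ioc_of_le zero_le_one).2 hint)
      rw [intervalIntegral.integral_of_le zero_le_one] at hftc
      have : u y - u x = ∫ t, φ' t ∂ν := by
        rw [hν, hftc]; simp [hγ]
      rw [this]
      exact enorm_integral_le_lintegral_enorm _
  have hLp : ‖u y - u x‖ₑ ≤ eLpNorm φ' (ENNReal.ofReal p) ν :=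
    hL1.trans (eLpNorm_le_eLpNorm_of_exponent_le (by simpa using hp) hφm.aestronglyMeasurable)
  calc ‖u y - u x‖ₑ ^ p ≤ eLpNorm φ' (ENNReal.ofReal p) ν ^ p :=
        ENNReal.rpow_le_rpow hLp hp0.le
    _ = ∫⁻ t, ‖φ' t‖ₑ ^ p ∂ν := by
        rw [eLpNorm_eq_lintegral_rpow_enorm_toReal (by simpa using hp0) ENNReal.ofReal_ne_top,
          ENNReal.toReal_ofReal hp0.le, ← ENNReal.rpow_mul, one_div_mul_cancel hp0.ne',
          ENNReal.rpow_one]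
    _ ≤ ∫⁻ t, ‖y - x‖ₑ ^ p * ‖fderiv ℝ u (γ t)‖ₑ ^ p ∂ν := by
        refine lintegral_mono fun t => ?_
        rw [← ENNReal.mul_rpow_of_nonneg _ _ hp0.le, mul_comm]
        exact ENNReal.rpow_le_rpow ((fderiv ℝ u (γ t)).le_opENorm (y - x)) hp0.le
    _ = _ := by
        rw [lintegral_const_mul]
        exact (((measurable_fderiv ℝ u).comp hγm).enorm).pow_const p

variable [MeasurableSpace E] [BorelSpace E] [FiniteDimensional ℝ E] (μ : Measure E)
  [μ.IsAddHaarMeasure]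

/-- Contracting a convex set by a factor `s ≥ 1 / 2` towards one of its points increases the
integral of a nonnegative function by a factor at most `2 ^ dim E`. -/
theorem setLIntegral_comp_convex_comb_le {K : Set E} (hK : Convex ℝ K) (hKm : MeasurableSet K)
    {F : E → ℝ≥0∞} (hF : Measurable F) {y : E} (hy : y ∈ K) {s : ℝ} (hs : 1 / 2 ≤ s)
    (hs1 : s ≤ 1) :
    ∫⁻ x in K, F (s • x + (1 - s) • y) ∂μ ≤ 2 ^ Module.finrank ℝ E * ∫⁻ x in K, F x ∂μ := by
  have hs0 : 0 < s := by linarith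
  have hmap : Measurable fun x : E => s • x := measurable_const_smul s
  have hGm : Measurable (K.indicator F) := hF.indicator hKm
  calc ∫⁻ x in K, F (s • x + (1 - s) • y) ∂μ
      = ∫⁻ x in K, K.indicator F (s • x + (1 - s) • y) ∂μ := by
        refine setLIntegral_congr_fun hKm fun x hx => ?_
        have : s • x + (1 - s) • y ∈ K := hK hx hy hs0.le (by linarith) (by ring)
        simp [this]
    _ ≤ ∫⁻ x, K.indicator F (s • x + (1 - s) • y) ∂μ := setLIntegral_le_lintegral _ _
    _ = ∫⁻ z, K.indicator F (z + (1 - s) • y) ∂(Measure.map (fun x : E => s • x) μ) := by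
        rw [lintegral_map (f := fun z => K.indicator F (z + (1 - s) • y))
          (hGm.comp (measurable_add_const _)) hmap]
    _ = ENNReal.ofReal |(s ^ Module.finrank ℝ E)⁻¹| * ∫⁻ z, K.indicator F z ∂μ := by
        rw [Measure.map_addHaar_smul μ hs0.ne', lintegral_smul_measure,
          lintegral_add_right_eq_self (K.indicator F)]
        rfl
    _ ≤ 2 ^ Module.finrank ℝ E * ∫⁻ x in K, F x ∂μ := by
        rw [lintegral_indicator hKm]
        gcongr
        have h2 : |(s ^ Module.finrank ℝ E)⁻¹| ≤ 2 ^ Module.finrank ℝ E := by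
          rw [abs_of_pos (by positivity), ← inv_pow]
          gcongr
          rw [inv_le_comm₀ hs0 two_pos]; linarith
        calc ENNReal.ofReal |(s ^ Module.finrank ℝ E)⁻¹|
            ≤ ENNReal.ofReal (2 ^ Module.finrank ℝ E) := ENNReal.ofReal_le_ofReal h2
          _ = 2 ^ Module.finrank ℝ E := by
            rw [ENNReal.ofReal_pow two_pos.le]; simp

theorem setLIntegral_setLIntegral_convex_comb_le [SFinite μ] {K : Set E} (hK : Convex ℝ K)
    (hKm : MeasurableSet K) {F : E → ℝ≥0∞} (hF : Measurable F) {t : ℝ} (ht : t ∈ Icc (0 : ℝ) 1) :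
    ∫⁻ y in K, ∫⁻ x in K, F ((1 - t) • x + t • y) ∂μ ∂μ ≤
      2 ^ Module.finrank ℝ E * (∫⁻ x in K, F x ∂μ) * μ K := by
  rcases le_total t (1 / 2) with h | h
  · rw [← setLIntegral_const]
    refine setLIntegral_mono' hKm fun y hy => ?_
    have := setLIntegral_comp_convex_comb_le μ hK hKm hF hy (s := 1 - t) (by linarith)
      (by linarith [ht.1])
    simpa using this
  · rw [lintegral_lintegral_swap, ← setLIntegral_const]
    · refine setLIntegral_mono' hKm fun x hx => ?_
      have := setLIntegral_comp_convex_comb_le μ hK hKm hF hx h ht.2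
      simpa only [add_comm] using this
    · refine (hF.comp ?_).aemeasurable
      exact Continuous.measurable (by fun_prop)

/-- **Poincaré inequality on a bounded convex set**, with the value of `u` at a suitable point in
place of its mean. -/
theorem exists_setLIntegral_enorm_sub_rpow_le [SFinite μ] {K : Set E} (hK : Convex ℝ K)
    (hKm : MeasurableSet K) (hK0 : μ K ≠ 0) (hKfin : μ K ≠ ⊤) {u : E → ℝ}
    (hu : ∀ x ∈ K, DifferentiableAt ℝ u x) {p : ℝ} (hp : 1 ≤ p) :
    ∃ y ∈ K, ∫⁻ x in K, ‖u x - u y‖ₑ ^ p ∂μ ≤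
      Metric.ediam K ^ p * (2 ^ Module.finrank ℝ E * ∫⁻ x in K, ‖fderiv ℝ u x‖ₑ ^ p ∂μ) := by
  have hp0 : 0 < p := zero_lt_one.trans_le hp
  set F : E → ℝ≥0∞ := fun x => ‖fderiv ℝ u x‖ₑ ^ p with hFdef
  have hF : Measurable F := (measurable_fderiv ℝ u).enorm.pow_const p
  set B : E → ℝ≥0∞ := fun y => ∫⁻ x in K, (∫⁻ t in Ioc (0 : ℝ) 1, F ((1 - t) • x + t • y)) ∂μ
    with hB
  have hF3 : Measurable fun q : (E × E) × ℝ => F ((1 - q.2) • q.1.2 + q.2 • q.1.1) :=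
    hF.comp (Continuous.measurable (by fun_prop))
  have hBm : Measurable B := by
    have h1 : Measurable fun q : E × E =>
        ∫⁻ t in Ioc (0 : ℝ) 1, F ((1 - t) • q.2 + t • q.1) := hF3.lintegral_prod_right'
    exact h1.lintegral_prod_right'
  obtain ⟨y, hy, hyB⟩ := exists_le_setLAverage hK0 hKfin hBm.aemeasurable
  have hBint : ∫⁻ y in K, B y ∂μ ≤ 2 ^ Module.finrank ℝ E * (∫⁻ x in K, F x ∂μ) * μ K := by
    have hswap : ∀ y, B y = ∫⁻ t in Ioc (0 : ℝ) 1, ∫⁻ x in K, F ((1 - t) • x + t • y) ∂μ := by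
      intro y
      refine lintegral_lintegral_swap (Measurable.aemeasurable ?_)
      exact hF.comp (Continuous.measurable (by fun_prop))
    simp_rw [hswap]
    rw [lintegral_lintegral_swap]
    · calc _ ≤ ∫⁻ _ in Ioc (0 : ℝ) 1, 2 ^ Module.finrank ℝ E * (∫⁻ x in K, F x ∂μ) * μ K :=
            setLIntegral_mono' measurableSet_Ioc fun t ht =>
              setLIntegral_setLIntegral_convex_comb_le μ hK hKm hF (Ioc_subset_Icc_self ht)
        _ = _ := by simp
    · have h1 : Measurable fun q : (E × ℝ) × E => F ((1 - q.1.2) • q.2 + q.1.2 • q.1.1) :=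
        hF.comp (Continuous.measurable (by fun_prop))
      exact h1.lintegral_prod_right'.aemeasurable
  refine ⟨y, hy, ?_⟩
  have hav : B y ≤ 2 ^ Module.finrank ℝ E * ∫⁻ x in K, F x ∂μ := by
    refine hyB.trans ?_
    rw [setLAverage_eq]
    exact ENNReal.div_le_of_le_mul hBint
  calc ∫⁻ x in K, ‖u x - u y‖ₑ ^ p ∂μ
      ≤ ∫⁻ x in K, Metric.ediam K ^ p *
          (∫⁻ t in Ioc (0 : ℝ) 1, F ((1 - t) • x + t • y)) ∂μ := by
        refine setLIntegral_mono' hKm fun x hx => ?_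
        rw [enorm_sub_rev]
        refine (enorm_sub_rpow_le_lintegral_fderiv_segment hp fun t ht =>
          hu _ (hK hx hy (by linarith [ht.2]) ht.1 (by ring))).trans ?_
        gcongr
        rw [← edist_eq_enorm_sub]
        exact Metric.edist_le_ediam_of_mem hy hx
    _ = Metric.ediam K ^ p * B y := by
        rw [lintegral_const_mul]
        have h1 : Measurable fun q : E × ℝ => F ((1 - q.2) • q.1 + q.2 • y) :=
          hF.comp (Continuous.measurable (by fun_prop))
        exact h1.lintegral_prod_right'
    _ ≤ _ := by gcongr

end ConvexPoincare

/-- Among constants, the mean is optimal for the `L^p` distance up to a factor `2`. -/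
theorem eLpNorm_sub_average_le {α : Type*} [MeasurableSpace α] {μ : Measure α} [IsFiniteMeasure μ]
    {u : α → ℝ} {q : ℝ≥0∞} (hq : 1 ≤ q) (hu : MemLp u q μ) (c : ℝ) :
    eLpNorm (fun x => u x - ⨍ z, u z ∂μ) q μ ≤ 2 * eLpNorm (fun x => u x - c) q μ := by
  rcases eq_or_ne μ 0 with rfl | hμ
  · simp
  have hμu : μ univ ≠ 0 := by simpa using hμ
  have hμt : μ univ ≠ ⊤ := measure_ne_top _ _
  have hq0 : q ≠ 0 := (zero_lt_one.trans_le hq).ne'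
  have hsub : AEStronglyMeasurable (fun x => u x - c) μ := hu.1.sub aestronglyMeasurable_const
  set m := ⨍ z, u z ∂μ with hm
  have hmc : ‖c - m‖ₑ * μ univ ≤ eLpNorm (fun x => u x - c) 1 μ := by
    have hi : Integrable u μ := hu.integrable hq
    have h1 : μ.real univ * (m - c) = ∫ x, (u x - c) ∂μ := by
      rw [integral_sub hi (integrable_const c), integral_const, mul_sub, smul_eq_mul,
        ← measure_smul_average μ u, smul_eq_mul]
    have h2 : ‖c - m‖ₑ * μ univ = ‖∫ x, (u x - c) ∂μ‖ₑ := by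
      rw [← h1, enorm_mul, mul_comm, enorm_sub_rev m c, Measure.real,
        Real.enorm_of_nonneg ENNReal.toReal_nonneg, ENNReal.ofReal_toReal hμt]
    rw [h2, eLpNorm_one_eq_lintegral_enorm]
    exact enorm_integral_le_lintegral_enorm _
  have hconst : eLpNorm (fun _ : α => c - m) q μ ≤ eLpNorm (fun x => u x - c) q μ := by
    have h1 := hmc.trans (eLpNorm_le_eLpNorm_mul_rpow_measure_univ hq hsub)
    set e := 1 / q.toReal with he
    rw [eLpNorm_const _ hq0 hμ]
    have h2 : μ univ = μ univ ^ e * μ univ ^ (1 - e) := by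
      rw [← ENNReal.rpow_add _ _ hμu hμt]; simp
    have h3 : μ univ ^ (1 - e) ≠ 0 := by simp [hμu, hμt]
    have h4 : μ univ ^ (1 - e) ≠ ⊤ := by simp [hμu, hμt]
    rw [ENNReal.toReal_one, div_one] at h1
    rw [← he]
    nth_rw 1 [h2] at h1
    rw [← mul_assoc] at h1
    exact (ENNReal.mul_le_mul_iff_left h3 h4).1 h1
  calc eLpNorm (fun x => u x - m) q μ
      = eLpNorm ((fun x => u x - c) + fun _ => c - m) q μ := by
        congr 1; ext x; simp
    _ ≤ eLpNorm (fun x => u x - c) q μ + eLpNorm (fun _ : α => c - m) q μ :=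
        eLpNorm_add_le hsub aestronglyMeasurable_const hq
    _ ≤ _ := by rw [two_mul]; gcongr

/-- The norm of a matrix whose entries are bounded by `B` is at most `n * B`. -/
theorem sqrt_sum_sum_sq_le {n : ℕ} {a : Fin n → Fin n → ℝ} {B : ℝ} (hB : 0 ≤ B)
    (h : ∀ i j, |a i j| ≤ B) : Real.sqrt (∑ i, ∑ j, a i j ^ 2) ≤ n * B := by
  refine Real.sqrt_le_iff.2 ⟨by positivity, ?_⟩
  calc ∑ i, ∑ j, a i j ^ 2 ≤ ∑ _i : Fin n, ∑ _j : Fin n, B ^ 2 :=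
        Finset.sum_le_sum fun i _ => Finset.sum_le_sum fun j _ =>
          sq_le_sq' (abs_le.1 (h i j)).1 (abs_le.1 (h i j)).2
    _ = (n * B) ^ 2 := by simp; ring

theorem abs_pder_le_DvLen {n : ℕ} (v : Evec n → Evec n) (i j : Fin n) (x : Evec n) :
    |pder v i j x| ≤ DvLen v x := by
  refine Real.abs_le_sqrt ?_
  calc pder v i j x ^ 2 ≤ ∑ j', pder v i j' x ^ 2 :=
        Finset.single_le_sum (f := fun j' => pder v i j' x ^ 2)
          (fun _ _ => sq_nonneg _) (Finset.mem_univ j)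
    _ ≤ ∑ i', ∑ j', pder v i' j' x ^ 2 :=
        Finset.single_le_sum (f := fun i' => ∑ j', pder v i' j' x ^ 2)
          (fun _ _ => Finset.sum_nonneg fun _ _ => sq_nonneg _) (Finset.mem_univ i)

theorem measurable_DvLen {n : ℕ} (v : Evec n → Evec n) : Measurable (DvLen v) := by
  have h : ∀ i j, Measurable (pder v i j) := fun i j =>
    (EuclideanSpace.proj (𝕜 := ℝ) i).continuous.measurable.comp
      (measurable_fderiv_apply_const ℝ v (EuclideanSpace.single j 1))
  unfold DvLen
  fun_prop

theorem measurable_gradLen {n : ℕ} (u : Evec n → ℝ) : Measurable (gradLen u) :=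
  (measurable_fderiv ℝ u).norm

theorem abs_fderiv_single_le_gradLen {n : ℕ} (w : Evec n → ℝ) (x : Evec n) (j : Fin n) :
    |fderiv ℝ w x (EuclideanSpace.single j 1)| ≤ gradLen w x := by
  simpa [gradLen] using (fderiv ℝ w x).le_opNorm (EuclideanSpace.single j 1)

section SkewField

variable {n : ℕ} {w : Evec n → ℝ} {x : Evec n} (b : Evec n →L[ℝ] Evec n)

theorem pder_smul_clm (hw : DifferentiableAt ℝ w x) (i j : Fin n) :
    pder (fun z => w z • b z) i j x =
      w x * b (EuclideanSpace.single j 1) i +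
        fderiv ℝ w x (EuclideanSpace.single j 1) * b x i := by
  have h := (hw.hasFDerivAt.smul b.hasFDerivAt).fderiv
  have h' : fderiv ℝ (fun z => w z • b z) x = w x • b + (fderiv ℝ w x).smulRight (b x) := h
  simp [pder, h']

theorem abs_fderiv_mul_apply_le {M : ℝ} (hM : ‖b x‖ ≤ M) (i j : Fin n) :
    |fderiv ℝ w x (EuclideanSpace.single j 1) * b x i| ≤ M * gradLen w x := by
  rw [abs_mul, mul_comm]
  exact mul_le_mul ((PiLp.norm_apply_le (b x) i).trans hM) (abs_fderiv_single_le_gradLen w x j)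
    (abs_nonneg _) ((norm_nonneg _).trans hM)

theorem DvLen_smul_clm_le (hw : DifferentiableAt ℝ w x) {M : ℝ} (hM : ‖b x‖ ≤ M) :
    DvLen (fun z => w z • b z) x ≤ n * (‖b‖ * ‖w x‖ + M * gradLen w x) := by
  have hM0 : 0 ≤ M := (norm_nonneg _).trans hM
  have hg : 0 ≤ gradLen w x := norm_nonneg _
  refine sqrt_sum_sum_sq_le (by positivity) fun i j => ?_
  rw [pder_smul_clm b hw]
  refine (abs_add_le _ _).trans (add_le_add ?_ (abs_fderiv_mul_apply_le b hM i j))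
  rw [abs_mul, mul_comm, ← Real.norm_eq_abs (w x)]
  gcongr
  refine (PiLp.norm_apply_le (b (EuclideanSpace.single j 1)) i).trans ?_
  simpa using b.le_opNorm (EuclideanSpace.single j 1)

/-- For a skew-symmetric `b`, the symmetric gradient of `w • b` only involves `∇w`. -/
theorem epsLen_smul_clm_le (hw : DifferentiableAt ℝ w x) {M : ℝ} (hM : ‖b x‖ ≤ M)
    (hb : ∀ i j, b (EuclideanSpace.single j 1) i = -b (EuclideanSpace.single i 1) j) :
    epsLen (fun z => w z • b z) x ≤ n * (M * gradLen w x) := by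
  have hM0 : 0 ≤ M := (norm_nonneg _).trans hM
  have hg : 0 ≤ gradLen w x := norm_nonneg _
  refine sqrt_sum_sum_sq_le (by positivity) fun i j => ?_
  rw [pder_smul_clm b hw, pder_smul_clm b hw, hb i j]
  have h1 := abs_le.1 (abs_fderiv_mul_apply_le (w := w) b hM i j)
  have h2 := abs_le.1 (abs_fderiv_mul_apply_le (w := w) b hM j i)
  rw [abs_le]
  constructor <;> linarith [h1.1, h1.2, h2.1, h2.2]

theorem norm_le_DvLen_smul_clm_add (hw : DifferentiableAt ℝ w x) {M : ℝ} (hM : ‖b x‖ ≤ M)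
    {i j : Fin n} (hij : b (EuclideanSpace.single j 1) i = 1) :
    ‖w x‖ ≤ DvLen (fun z => w z • b z) x + M * gradLen w x := by
  have h1 := abs_pder_le_DvLen (fun z => w z • b z) i j x
  rw [pder_smul_clm b hw, hij, mul_one] at h1
  have h2 := abs_fderiv_mul_apply_le (w := w) b hM i j
  have h3 := abs_sub (w x + fderiv ℝ w x (EuclideanSpace.single j 1) * b x i)
    (fderiv ℝ w x (EuclideanSpace.single j 1) * b x i)
  rw [add_sub_cancel_right] at h3
  exact h3.trans (add_le_add h1 h2)

end SkewField

/-- In dimension at least two there is a nontrivial infinitesimal rotation. -/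
theorem exists_skew_clm {n : ℕ} (hn : 2 ≤ n) : ∃ (b : Evec n →L[ℝ] Evec n) (i₀ j₀ : Fin n),
    (∀ i j, b (EuclideanSpace.single j 1) i = -b (EuclideanSpace.single i 1) j) ∧
      b (EuclideanSpace.single j₀ 1) i₀ = 1 := by
  have hne : (⟨0, by lia⟩ : Fin n) ≠ ⟨1, by lia⟩ := by simp
  generalize (⟨0, by lia⟩ : Fin n) = i₀, (⟨1, by lia⟩ : Fin n) = j₀ at hne
  refine ⟨(EuclideanSpace.proj (𝕜 := ℝ) j₀).smulRight (EuclideanSpace.single i₀ (1 : ℝ)) -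
    (EuclideanSpace.proj (𝕜 := ℝ) i₀).smulRight (EuclideanSpace.single j₀ (1 : ℝ)), i₀, j₀,
    fun i j => ?_, ?_⟩
  · simp only [sub_apply, ContinuousLinearMap.smulRight_apply, PiLp.proj_apply, PiLp.sub_apply,
      PiLp.smul_apply, PiLp.single_apply, smul_eq_mul, eq_comm (a := i), eq_comm (a := j)]
    ring
  · simp [hne]

theorem IsClosedCube.isClosed {n : ℕ} {Q : Set (Evec n)} (hQ : IsClosedCube Q) : IsClosed Q := by
  obtain ⟨c, r, -, rfl⟩ := hQ
  simp only [ofPred_forall]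
  exact isClosed_iInter fun i => isClosed_le (by fun_prop) continuous_const

theorem IsClosedCube.convex {n : ℕ} {Q : Set (Evec n)} (hQ : IsClosedCube Q) : Convex ℝ Q := by
  obtain ⟨c, r, -, rfl⟩ := hQ
  intro x hx y hy s t hs ht hst i
  have h1 := abs_le.1 (hx i)
  have h2 := abs_le.1 (hy i)
  have h3 : (s • x + t • y) i - c i = s * (x i - c i) + t * (y i - c i) := by
    simp only [PiLp.add_apply, PiLp.smul_apply, smul_eq_mul]
    linear_combination (c i) * hst
  rw [h3, abs_le]
  constructor <;> nlinarith [h1.1, h1.2, h2.1, h2.2]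

theorem IsClosedCube.measure_ne_zero {n : ℕ} {Q : Set (Evec n)} (hQ : IsClosedCube Q) :
    volume Q ≠ 0 := by
  obtain ⟨c, r, hr, rfl⟩ := hQ
  refine ((Metric.measure_ball_pos volume c hr).trans_le (measure_mono ?_)).ne'
  intro x hx i
  exact (PiLp.norm_apply_le (x - c) i).trans (mem_ball_iff_norm.1 hx).le

theorem wAvg_zero_eq_average {n : ℕ} (Ω : Set (Evec n)) (u : Evec n → ℝ) :
    wAvg Ω 0 u = ⨍ x in Ω, u x := by
  simp [wAvg, setAverage_eq]

/-- **Remark after Theorem 2.2.** If the Korn inequality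
`‖Dv‖_{L^p(Ω)} ≤ C { ‖ε(v)‖_{L^p(Ω)} + ‖v‖_{L^p(Q)} }` holds for all
`v ∈ W^{1,p}(Ω)ⁿ` and a cube `Q ⊂⊂ Ω`, then the Poincaré inequality
`∫_Ω |u − u_Ω|^p ≤ C' ∫_Ω |∇u|^p` holds for all `u ∈ W^{1,p}(Ω)`. -/
theorem korn_local_v_implies_poincare {n : ℕ} (hn : 2 ≤ n) (Ω Q : Set (Evec n)) (p : ℝ)
    (hΩ : IsBoundedDomain Ω) (hp : 1 < p) (hQ : IsClosedCube Q) (hQΩ : Q ⊆ Ω) (C : ℝ)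
    (hK : ∀ v : Evec n → Evec n, MemW1Vec Ω p 0 0 v →
      wLp Ω Ω p 0 (DvLen v) ≤
        ENNReal.ofReal C * (wLp Ω Ω p 0 (epsLen v) + wLp Ω Q p 0 (fun x => ‖v x‖))) :
    ∃ C' > 0, ∀ u : Evec n → ℝ, MemW1 Ω p 0 0 u →
      wIp Ω Ω p 0 (fun x => u x - wAvg Ω 0 u) ≤
        ENNReal.ofReal C' * wIp Ω Ω p 0 (gradLen u) := by
  obtain ⟨hΩo, -, hΩb⟩ := hΩ
  have hp0 : 0 < p := zero_lt_one.trans hp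
  set q := ENNReal.ofReal p with hq
  have hq1 : 1 ≤ q := by simpa [hq] using hp.le
  set μ : Measure (Evec n) := volume.restrict Ω with hμ
  have : IsFiniteMeasure μ := ⟨by simpa [hμ] using hΩb.measure_lt_top⟩
  obtain ⟨b, i₀, j₀, hskew, hone⟩ := exists_skew_clm hn
  obtain ⟨R, hR⟩ := hΩb.exists_norm_le
  set M := ‖b‖ * R with hMdef
  have hM : ∀ x ∈ Ω, ‖b x‖ ≤ M := fun x hx =>
    (b.le_opNorm x).trans (mul_le_mul_of_nonneg_left (hR x hx) (norm_nonneg _))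
  have hQb : Bornology.IsBounded Q := hΩb.subset hQΩ
  have hQm : MeasurableSet Q := hQ.isClosed.measurableSet
  set D : ℝ≥0∞ := (Metric.ediam Q ^ p * 2 ^ n) ^ (1 / p) with hD
  have hDt : D ≠ ⊤ :=
    ENNReal.rpow_ne_top_of_nonneg (by positivity) (ENNReal.mul_ne_top
      (ENNReal.rpow_ne_top_of_nonneg hp0.le hQb.ediam_ne_top) (by finiteness))
  set K : ℝ≥0∞ := ENNReal.ofReal C * (ENNReal.ofReal (n * M) + ENNReal.ofReal M * D) +
    ENNReal.ofReal M with hKdef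
  have hKt : (2 * K) ^ p ≠ ⊤ := by
    refine ENNReal.rpow_ne_top_of_nonneg hp0.le ?_
    rw [hKdef]
    finiteness
  refine ⟨((2 * K) ^ p).toReal + 1, by positivity, fun u hu => ?_⟩
  obtain ⟨hud, huL, hugL⟩ := hu
  have hdiff : ∀ x ∈ Ω, DifferentiableAt ℝ u x := fun x hx =>
    hud.differentiableAt (hΩo.mem_nhds hx)
  have huLp : MemLp u q μ := by
    refine ⟨hud.continuousOn.aestronglyMeasurable hΩo.measurableSet, ?_⟩
    rw [wIp_zero_eq_eLpNorm_rpow Ω Ω hp0] at huL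
    exact ENNReal.rpow_lt_top_iff_of_pos hp0 |>.1 huL
  have hgLp : MemLp (gradLen u) q μ := by
    refine ⟨(measurable_gradLen u).aestronglyMeasurable, ?_⟩
    rw [wIp_zero_eq_eLpNorm_rpow Ω Ω hp0] at hugL
    exact ENNReal.rpow_lt_top_iff_of_pos hp0 |>.1 hugL
  obtain ⟨y, hy, hyQ⟩ := exists_setLIntegral_enorm_sub_rpow_le volume hQ.convex hQm
    hQ.measure_ne_zero hQb.measure_lt_top.ne (fun x hx => hdiff x (hQΩ hx)) hp.le
  set w : Evec n → ℝ := fun x => u x - u y with hwdef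
  have hgw : gradLen w = gradLen u := by
    ext x
    simp [gradLen, hwdef, fderiv_sub_const]
  have hwd : ∀ x ∈ Ω, DifferentiableAt ℝ w x := fun x hx => (hdiff x hx).sub_const _
  have hwLp : MemLp w q μ := huLp.sub (memLp_const _)
  have hwQ : eLpNorm w q (volume.restrict Q) ≤ D * eLpNorm (gradLen u) q μ := by
    have h1 : eLpNorm w q (volume.restrict Q) ^ p ≤ (D * eLpNorm (gradLen u) q μ) ^ p := by
      rw [← wIp_zero_eq_eLpNorm_rpow Ω Q hp0, wIp_zero_eq_lintegral Ω Q hp0.le,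
        ENNReal.mul_rpow_of_nonneg _ _ hp0.le, ← wIp_zero_eq_eLpNorm_rpow Ω Ω hp0,
        wIp_zero_eq_lintegral Ω Ω hp0.le, hD, ← ENNReal.rpow_mul, one_div_mul_cancel hp0.ne',
        ENNReal.rpow_one]
      refine hyQ.trans ?_
      rw [finrank_euclideanSpace_fin, mul_assoc]
      gcongr
      simp [gradLen]
    exact (ENNReal.rpow_le_rpow_iff hp0).1 h1
  set v : Evec n → Evec n := fun x => w x • b x with hv
  have hvnorm : ∀ x ∈ Ω, ‖‖v x‖‖ ≤ M * ‖w x‖ := fun x hx => by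
    rw [norm_norm, hv, norm_smul, mul_comm]
    gcongr
    exact hM x hx
  have hvMem : MemW1Vec Ω p 0 0 v := by
    refine ⟨fun x hx =>
      ((hwd x hx).smul b.differentiableAt).differentiableWithinAt, ?_, ?_⟩
    · rw [wIp_zero_eq_eLpNorm_rpow Ω Ω hp0]
      refine ENNReal.rpow_lt_top_of_nonneg hp0.le (ne_of_lt ?_)
      refine (eLpNorm_mono_ae_real (ae_restrict_of_forall_mem hΩo.measurableSet hvnorm)).trans_lt ?_
      exact (hwLp.norm.const_mul M).2
    · rw [wIp_zero_eq_eLpNorm_rpow Ω Ω hp0]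
      refine ENNReal.rpow_lt_top_of_nonneg hp0.le (ne_of_lt ?_)
      have hle : ∀ x ∈ Ω, ‖DvLen v x‖ ≤ n * (‖b‖ * ‖w x‖ + M * gradLen u x) := fun x hx => by
        rw [← hgw]
        refine (Real.norm_of_nonneg (Real.sqrt_nonneg _)).trans_le ?_
        exact DvLen_smul_clm_le b (hwd x hx) (hM x hx)
      refine (eLpNorm_mono_ae_real (ae_restrict_of_forall_mem hΩo.measurableSet hle)).trans_lt ?_
      exact (((hwLp.norm.const_mul ‖b‖).add (hgLp.const_mul M)).const_mul (n : ℝ)).2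
  have hkorn := hK v hvMem
  rw [wLp_zero_eq_eLpNorm Ω Ω hp0, wLp_zero_eq_eLpNorm Ω Ω hp0,
    wLp_zero_eq_eLpNorm Ω Q hp0] at hkorn
  have heps : eLpNorm (epsLen v) q μ ≤ ENNReal.ofReal (n * M) * eLpNorm (gradLen u) q μ := by
    refine eLpNorm_le_mul_eLpNorm_of_ae_le_mul (ae_restrict_of_forall_mem hΩo.measurableSet
      fun x hx => ?_) q
    rw [← hgw, mul_assoc, Real.norm_of_nonneg (show 0 ≤ gradLen w x from norm_nonneg _)]
    refine (Real.norm_of_nonneg (Real.sqrt_nonneg _)).trans_le ?_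
    exact epsLen_smul_clm_le b (hwd x hx) (hM x hx) hskew
  have hvQ : eLpNorm (fun x => ‖v x‖) q (volume.restrict Q) ≤
      ENNReal.ofReal M * (D * eLpNorm (gradLen u) q μ) :=
    (eLpNorm_le_mul_eLpNorm_of_ae_le_mul (ae_restrict_of_forall_mem hQm
      fun x hx => hvnorm x (hQΩ hx)) q).trans (by gcongr)
  have hwΩ : eLpNorm w q μ ≤ K * eLpNorm (gradLen u) q μ := by
    calc eLpNorm w q μ ≤ eLpNorm (fun x => DvLen v x + M * gradLen u x) q μ :=
          eLpNorm_mono_ae_real (ae_restrict_of_forall_mem hΩo.measurableSet fun x hx => by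
            rw [← hgw]
            exact norm_le_DvLen_smul_clm_add b (hwd x hx) (hM x hx) hone)
      _ ≤ eLpNorm (DvLen v) q μ + eLpNorm (fun x => M * gradLen u x) q μ :=
          eLpNorm_add_le (measurable_DvLen v).aestronglyMeasurable
            (hgLp.const_mul M).1 hq1
      _ ≤ ENNReal.ofReal C * (ENNReal.ofReal (n * M) * eLpNorm (gradLen u) q μ +
            ENNReal.ofReal M * (D * eLpNorm (gradLen u) q μ)) +
            ENNReal.ofReal M * eLpNorm (gradLen u) q μ := by
          have hM0 : 0 ≤ M := (norm_nonneg _).trans (hM y (hQΩ hy))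
          gcongr
          · exact hkorn.trans (by gcongr)
          · refine eLpNorm_le_mul_eLpNorm_of_ae_le_mul (Eventually.of_forall fun x => ?_) q
            rw [norm_mul, Real.norm_of_nonneg hM0]
      _ = K * eLpNorm (gradLen u) q μ := by rw [hKdef]; ring
  rw [wIp_zero_eq_eLpNorm_rpow Ω Ω hp0, wIp_zero_eq_eLpNorm_rpow Ω Ω hp0, wAvg_zero_eq_average]
  calc eLpNorm (fun x => u x - ⨍ z, u z ∂μ) q μ ^ p
      ≤ (2 * (K * eLpNorm (gradLen u) q μ)) ^ p :=
        ENNReal.rpow_le_rpow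
          ((eLpNorm_sub_average_le hq1 huLp (u y)).trans (by gcongr)) hp0.le
    _ = (2 * K) ^ p * eLpNorm (gradLen u) q μ ^ p := by
        rw [← mul_assoc, ENNReal.mul_rpow_of_nonneg _ _ hp0.le]
    _ ≤ ENNReal.ofReal (((2 * K) ^ p).toReal + 1) * eLpNorm (gradLen u) q μ ^ p := by
        gcongr
        rw [← ENNReal.ofReal_toReal hKt, ENNReal.toReal_ofReal ENNReal.toReal_nonneg]
        exact ENNReal.ofReal_le_ofReal (by linarith)
end
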